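/- Let d ≥ 1, m ∈ ℝ, and a ∈ S^m_{1,1}. Then for every N > 0 and σ > 0 there is a constant C (independent of j, k, x, and f) such that for all integers j ≥ 3 and 0 ≤ k ≤ j − 3, all x ∈ ℝ^d, and all Schwartz functions f: |T_{a_{j,k}} f(x)| ≤ C · 2^{km} · 2^{−(j−k)N} · 𝔐_{σ,2^k}(Π*_k f)(x). -/

import Mathlib

noncomputable section

open MeasureTheory SchwartzMap Complex RealInnerProductSpace Filter
open scoped ENNReal NNReal ContDiff SchwartzMap

/-- Euclidean space `ℝ^d`. -/
abbrev RD (d : ℕ) : Type := EuclideanSpace ℝ (Fin d)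

/-- Tempered distributions on `ℝ^d`. -/
abbrev TD (d : ℕ) : Type := 𝓢(RD d, ℂ) →L[ℂ] ℂ

/-- Fourier transform of a Schwartz function (with the convention
`f̂(ξ) = ∫ f(x) e^{-2πi⟨x,ξ⟩} dx`). -/
def fourierS {d : ℕ} (f : 𝓢(RD d, ℂ)) : 𝓢(RD d, ℂ) :=
  SchwartzMap.fourierTransformCLM ℂ f

/-- Hörmander symbol class `S^m_{1,1}`: `a` is smooth and
`‖∂_ξ^α ∂_x^β a(x,ξ)‖ ≤ c_{α,β} (1+‖ξ‖)^{m-|α|+|β|}` for all orders of derivatives. -/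
def IsSymbolS11 (d : ℕ) (m : ℝ) (a : RD d → RD d → ℂ) : Prop :=
  ContDiff ℝ ∞ (fun p : RD d × RD d => a p.1 p.2) ∧
  ∀ α β : ℕ, ∃ c : ℝ, ∀ x ξ : RD d,
    ‖iteratedFDeriv ℝ α (fun ξ' => iteratedFDeriv ℝ β (fun x' => a x' ξ') x) ξ‖
      ≤ c * (1 + ‖ξ‖) ^ (m - (α : ℝ) + (β : ℝ))

/-- The pseudo-differential operator `T_a f(x) = ∫ a(x,ξ) f̂(ξ) e^{2πi⟨x,ξ⟩} dξ`
acting on a Schwartz function `f`. -/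
def pdo {d : ℕ} (a : RD d → RD d → ℂ) (f : 𝓢(RD d, ℂ)) (x : RD d) : ℂ :=
  ∫ ξ, a x ξ * fourierS f ξ * Complex.exp (2 * Real.pi * Complex.I * ((⟪x, ξ⟫ : ℝ) : ℂ))

/-- Littlewood–Paley data: a Schwartz function `φ` with `φ̂` supported in
`{1/2 ≤ |ξ| ≤ 2}` and `Σ_{k∈ℤ} φ̂(2^{-k}ξ) = 1` for `ξ ≠ 0`, together with the
low-frequency piece `Φ` determined by `Φ̂ = 1 - Σ_{k≥1} φ̂(2^{-k}·)`. -/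
structure LPData (d : ℕ) where
  φ : 𝓢(RD d, ℂ)
  Φ : 𝓢(RD d, ℂ)
  supp_φ : ∀ ξ : RD d, fourierS φ ξ ≠ 0 → 1/2 ≤ ‖ξ‖ ∧ ‖ξ‖ ≤ 2
  sum_φ : ∀ ξ : RD d, ξ ≠ 0 → HasSum (fun k : ℤ => fourierS φ ((2:ℝ)^(-k) • ξ)) 1
  Φ_def : ∀ ξ : RD d, fourierS Φ ξ = 1 - ∑' k : ℕ, fourierS φ (((2:ℝ)^(k+1))⁻¹ • ξ)

/-- The Littlewood–Paley convolution kernel: `Φ` for `k = 0` and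
`φ_k = 2^{kd} φ(2^k ·)` for `k ≥ 1`. -/
def LPkernel {d : ℕ} (D : LPData d) : ℕ → RD d → ℂ
  | 0, x => D.Φ x
  | (k+1), x => (((2:ℝ)^((k+1) * d) : ℝ) : ℂ) * D.φ ((2:ℝ)^(k+1) • x)

/-- The Fourier transform of the `k`-th Littlewood–Paley kernel, i.e. `φ̂_k = φ̂(2^{-k}·)`
for `k ≥ 1` and `Φ̂` for `k = 0`. -/
def LPhat {d : ℕ} (D : LPData d) : ℕ → RD d → ℂ
  | 0, ξ => fourierS D.Φ ξ
  | (k+1), ξ => fourierS D.φ (((2:ℝ)^(k+1))⁻¹ • ξ)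

/-- Littlewood–Paley operator `Π_k g = φ_k ∗ g` (with `φ_0 := Φ`) acting on functions. -/
def LP {d : ℕ} (D : LPData d) (k : ℕ) (g : RD d → ℂ) (x : RD d) : ℂ :=
  ∫ y, LPkernel D k y * g (x - y)

/-- `Π*_k = Π_{k-1} + Π_k + Π_{k+1}` (with the convention `φ_{-1} := 0`). -/
def LPstar {d : ℕ} (D : LPData d) (k : ℕ) (g : RD d → ℂ) (x : RD d) : ℂ :=
  (if k = 0 then 0 else LP D (k-1) g x) + LP D k g x + LP D (k+1) g x

open Classical in
/-- Pairing of a tempered distribution with a plain function: it gives `u ψ` if the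
function is (the coercion of) a Schwartz function `ψ`, and `0` otherwise. -/
def pairing {d : ℕ} (u : TD d) (g : RD d → ℂ) : ℂ :=
  if h : ∃ ψ : 𝓢(RD d, ℂ), ⇑ψ = g then u h.choose else 0

/-- Fourier transform of a tempered distribution, `⟨û, ψ⟩ = ⟨u, ψ̂⟩`. -/
def fourierTD {d : ℕ} (u : TD d) : TD d :=
  u.comp (SchwartzMap.fourierTransformCLM ℂ)

/-- Littlewood–Paley operator on tempered distributions:
`Π_k u (x) = ⟨u, φ_k(x - ·)⟩`. -/
def LPdist {d : ℕ} (D : LPData d) (k : ℕ) (u : TD d) (x : RD d) : ℂ :=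
  pairing u (fun y => LPkernel D k (x - y))

/-- The symbol `a_{j,k}(x,ξ) = (φ_j ∗ a(·,ξ))(x) · φ̂_k(ξ)` (with `Φ` replacing `φ_0`). -/
def symbolPiece {d : ℕ} (D : LPData d) (a : RD d → RD d → ℂ) (j k : ℕ)
    (x ξ : RD d) : ℂ :=
  (∫ y, LPkernel D j y * a (x - y) ξ) * LPhat D k ξ

/-- `T_{a_{j,k}} u (x) = ⟨û, a_{j,k}(x,·) e^{2πi⟨x,·⟩}⟩` for a tempered distribution `u`. -/
def pdoPieceD {d : ℕ} (D : LPData d) (a : RD d → RD d → ℂ) (j k : ℕ)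
    (u : TD d) (x : RD d) : ℂ :=
  pairing (fourierTD u)
    (fun ξ => symbolPiece D a j k x ξ * Complex.exp (2 * Real.pi * Complex.I * ((⟪x, ξ⟫ : ℝ) : ℂ)))

/-- Partial sums `Σ_{j=0}^N Σ_{k=0}^N T_{a_{j,k}} u (x)`. -/
def pdoPartial {d : ℕ} (D : LPData d) (a : RD d → RD d → ℂ) (N : ℕ)
    (u : TD d) (x : RD d) : ℂ :=
  ∑ j ∈ Finset.range (N+1), ∑ k ∈ Finset.range (N+1), pdoPieceD D a j k u x

/-- `T_a u` converges in `S'` to the tempered distribution `Tf`: the partial sums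
`Σ_{j,k≤N} T_{a_{j,k}} u` (which are functions) converge to `Tf` weakly. -/
def ConvergesInSPrime {d : ℕ} (D : LPData d) (a : RD d → RD d → ℂ)
    (u : TD d) (Tf : TD d) : Prop :=
  ∀ ψ : 𝓢(RD d, ℂ),
    Tendsto (fun N => ∫ x, pdoPartial D a N u x * ψ x) atTop (nhds (Tf ψ))

/-- The dyadic cube of level `ν` (side length `2^{-ν}`) indexed by `n ∈ ℤ^d`. -/
def dyadicCube (d : ℕ) (ν : ℤ) (n : Fin d → ℤ) : Set (RD d) :=
  {x | ∀ i, (n i : ℝ) * (2:ℝ)^(-ν) ≤ x i ∧ x i < ((n i : ℝ) + 1) * (2:ℝ)^(-ν)}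

/-- The local quantity `(|P|⁻¹ ∫_P Σ_{k=k₀}^∞ 2^{skq} ‖g_k(x)‖^q dx)^{1/q}` for the
dyadic cube `P` of level `μ` indexed by `n` (so that `|P|⁻¹ = 2^{μd}`). -/
def cubePiece (d : ℕ) (μ : ℕ) (n : Fin d → ℤ) (k₀ : ℕ) (s q : ℝ)
    (g : ℕ → RD d → ℂ) : ℝ≥0∞ :=
  ((2:ℝ≥0∞)^((μ:ℝ)*(d:ℝ)) *
    ∫⁻ x in dyadicCube d μ n,
      ∑' j : ℕ, (2:ℝ≥0∞)^(s*((k₀:ℝ)+(j:ℝ))*q) * (‖g (k₀+j) x‖₊ : ℝ≥0∞)^q) ^ (1/q)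

/-- The `F_∞^{s,q}` norm (for `q < ∞`) of a function, computed from its
Littlewood–Paley pieces:
`‖Π_0 g‖_∞ + sup_{l(P)<1 dyadic} (|P|⁻¹ ∫_P Σ_{k=-log₂ l(P)}^∞ 2^{skq}|Π_k g|^q)^{1/q}`. -/
def FinftyNormFun {d : ℕ} (D : LPData d) (s q : ℝ) (g : RD d → ℂ) : ℝ≥0∞ :=
  (⨆ x : RD d, (‖LP D 0 g x‖₊ : ℝ≥0∞)) +
  ⨆ (μ : ℕ) (_ : 1 ≤ μ) (n : Fin d → ℤ),
    cubePiece d μ n μ s q (fun k x => LP D k g x)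

/-- The `F_∞^{s,q}` norm (for `q < ∞`) of a tempered distribution. -/
def FinftyNormDist {d : ℕ} (D : LPData d) (s q : ℝ) (u : TD d) : ℝ≥0∞ :=
  (⨆ x : RD d, (‖LPdist D 0 u x‖₊ : ℝ≥0∞)) +
  ⨆ (μ : ℕ) (_ : 1 ≤ μ) (n : Fin d → ℤ),
    cubePiece d μ n μ s q (fun k x => LPdist D k u x)

/-- The (axis-parallel, closed) cube with corner `c` and side length `L`. -/
def cube (d : ℕ) (c : RD d) (L : ℝ) : Set (RD d) :=
  {x | ∀ i, c i ≤ x i ∧ x i ≤ c i + L}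

/-- The average of `g` over the cube with corner `c` and side length `L`. -/
def cubeMean {d : ℕ} (c : RD d) (L : ℝ) (g : RD d → ℂ) : ℂ :=
  (L^d)⁻¹ • ∫ x in cube d c L, g x

/-- The `bmo` norm (local BMO):
`sup_{l(Q)≥1} |Q|⁻¹∫_Q |g| + sup_{l(Q)<1} |Q|⁻¹∫_Q |g - g_Q|`, over all cubes `Q`. -/
def bmoNorm (d : ℕ) (g : RD d → ℂ) : ℝ≥0∞ :=
  (⨆ (c : RD d) (L : ℝ) (_ : 1 ≤ L),
    ENNReal.ofReal ((L^d)⁻¹) * ∫⁻ x in cube d c L, (‖g x‖₊ : ℝ≥0∞)) +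
  (⨆ (c : RD d) (L : ℝ) (_ : 0 < L) (_ : L < 1),
    ENNReal.ofReal ((L^d)⁻¹) * ∫⁻ x in cube d c L, (‖g x - cubeMean c L g‖₊ : ℝ≥0∞))

/-- The Peetre maximal function `𝔐_{σ,R} g(x) = sup_y ‖g(x-y)‖/(1+R‖y‖)^σ`. -/
def peetre {d : ℕ} (σ R : ℝ) (g : RD d → ℂ) (x : RD d) : ℝ≥0∞ :=
  ⨆ y : RD d, (‖g (x - y)‖₊ : ℝ≥0∞) / ENNReal.ofReal ((1 + R * ‖y‖) ^ σ)

/-- `g` has (distributional) Fourier support contained in `K`: the pairing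
`⟨ĝ, ψ⟩ = ∫ g · ψ̂` vanishes for every Schwartz `ψ` whose support does not meet `K`. -/
def HasFourierSupportIn {d : ℕ} (g : RD d → ℂ) (K : Set (RD d)) : Prop :=
  ∀ ψ : 𝓢(RD d, ℂ), tsupport ⇑ψ ∩ K = ∅ → ∫ x, g x * fourierS ψ x = 0

section Auxiliary

open scoped FourierTransform Topology

theorem integral_prod_inner_smul_eq_zero {d : ℕ} {φ : 𝓢(RD d, ℂ)}
    (hφ : ⇑(fourierS φ) =ᶠ[𝓝 0] 0) {n : ℕ} (w : Fin n → RD d) :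
    ∫ v, (∏ i, ⟪v, w i⟫) • φ v = 0 := by
  have hint : ∀ n : ℕ, (n : ℕ∞) ≤ (⊤ : ℕ∞) → Integrable (fun v ↦ ‖v‖ ^ n * ‖φ v‖) :=
    fun n _ => φ.integrable_pow_mul volume n
  have h := Real.iteratedFDeriv_fourier hint φ.continuous.aestronglyMeasurable (n := n) le_top
  have h0 : iteratedFDeriv ℝ n (𝓕 (φ : RD d → ℂ)) 0 = 0 := by
    have : (𝓕 (φ : RD d → ℂ)) =ᶠ[𝓝 0] (0 : RD d → ℂ) := hφ
    rw [(this.iteratedFDeriv ℝ n).eq_of_nhds]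
    simp
  rw [h] at h0
  have h1 := congrArg (fun T => T w) h0
  simp only [Real.fourier_continuousMultilinearMap_apply
    (VectorFourier.integrable_fourierPowSMulRight (innerSL ℝ) (hint n le_top)
      φ.continuous.aestronglyMeasurable)] at h1
  simp only [Real.fourier_eq, VectorFourier.fourierPowSMulRight_apply, inner_zero_right, neg_zero,
    AddChar.map_zero_eq_one, one_smul, integral_smul, zero_apply,
    smul_eq_zero] at h1
  refine h1.resolve_left ?_
  simp [Real.pi_ne_zero]

theorem integrable_multilinear_mul {d : ℕ} (φ : 𝓢(RD d, ℂ)) {n : ℕ}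
    (M : ContinuousMultilinearMap ℝ (fun _ : Fin n => RD d) ℂ) :
    Integrable (fun v => φ v * M (fun _ => v)) := by
  refine ((φ.integrable_pow_mul volume n).const_mul ‖M‖).mono' ?_ (ae_of_all _ fun v => ?_)
  · have : Continuous fun v : RD d => M (fun _ => v) := M.cont.comp (by fun_prop)
    exact (φ.continuous.mul this).aestronglyMeasurable
  · rw [norm_mul]
    have := M.le_opNorm (fun _ => v)
    simp only [Finset.prod_const, Finset.card_univ, Fintype.card_fin] at this
    calc _ ≤ ‖φ v‖ * (‖M‖ * ‖v‖ ^ n) := by gcongr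
      _ = _ := by ring

theorem integral_mul_multilinear_eq_zero {d : ℕ} {φ : 𝓢(RD d, ℂ)}
    (hφ : ⇑(fourierS φ) =ᶠ[𝓝 0] 0) {n : ℕ}
    (M : ContinuousMultilinearMap ℝ (fun _ : Fin n => RD d) ℂ) :
    ∫ v, φ v * M (fun _ => v) = 0 := by
  set b := EuclideanSpace.basisFun (Fin d) ℝ
  have hexp : ∀ v : RD d, φ v * M (fun _ => v) =
      ∑ r : Fin n → Fin d, ((∏ i, ⟪v, b (r i)⟫) • φ v) * M (fun i => b (r i)) := by
    intro v
    have hv : (fun _ : Fin n => v) = fun _ : Fin n => ∑ s, ⟪v, b s⟫ • b s := by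
      funext _
      refine (b.sum_repr' v).symm.trans (Finset.sum_congr rfl fun s _ => ?_)
      rw [real_inner_comm]
    conv_lhs => rw [hv, M.map_sum, Finset.mul_sum]
    refine Finset.sum_congr rfl fun r _ => ?_
    rw [M.map_smul_univ (fun i => ⟪v, b (r i)⟫) (fun i => b (r i))]
    simp only [Complex.real_smul]
    ring
  have hint : ∀ r : Fin n → Fin d, Integrable fun v => (∏ i, ⟪v, b (r i)⟫) • φ v := by
    intro r
    refine (φ.integrable_pow_mul volume n).mono' ?_ (ae_of_all _ fun v => ?_)
    · refine Continuous.aestronglyMeasurable ?_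
      have : Continuous fun v : RD d => ∏ i, ⟪v, b (r i)⟫ :=
        continuous_finsetProd _ fun i _ => continuous_id.inner continuous_const
      exact this.smul φ.continuous
    · rw [norm_smul, norm_prod]
      gcongr
      calc _ ≤ ∏ _i : Fin n, ‖v‖ := Finset.prod_le_prod (fun _ _ => norm_nonneg _) fun i _ => by
            simpa using norm_inner_le_norm (𝕜 := ℝ) v (b (r i))
        _ = _ := by simp
  simp_rw [hexp]
  rw [integral_finsetSum _ fun r _ => (hint r).mul_const _]
  refine Finset.sum_eq_zero fun r _ => ?_
  rw [integral_mul_const, integral_prod_inner_smul_eq_zero hφ, zero_mul]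

/-- Taylor's formula with integral remainder, along the segment from `x` to `x + w`. -/
theorem taylor_segment {E : Type*} [NormedAddCommGroup E] [NormedSpace ℝ E] {g : E → ℂ}
    (hg : ContDiff ℝ ∞ g) (n : ℕ) (x w : E) :
    g (x + w) = (∑ l ∈ Finset.range (n + 1),
        ((l.factorial : ℝ)⁻¹) • iteratedFDeriv ℝ l g x (fun _ => w)) +
      ∫ t in (0 : ℝ)..1, ((1 - t) ^ n / n.factorial) •
        iteratedFDeriv ℝ (n + 1) g (x + t • w) (fun _ => w) := by
  set f : ℝ → ℂ := fun t => g (x + t • w)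
  have hf : ContDiff ℝ ∞ f := hg.comp (by fun_prop)
  have hder : ∀ l : ℕ, ∀ t ∈ Set.uIcc (0 : ℝ) 1, iteratedDerivWithin l f (Set.uIcc 0 1) t =
      iteratedFDeriv ℝ l g (x + t • w) (fun _ => w) := by
    intro l t ht
    rw [iteratedDerivWithin_eq_iteratedDeriv (uniqueDiffOn_uIcc zero_ne_one)
      ((hf.of_le (mod_cast le_top)).contDiffAt) ht, iteratedDeriv_eq_iteratedFDeriv]
    have : f = (fun y => g (x + y)) ∘ ((1 : ℝ →L[ℝ] ℝ).smulRight w) := by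
      funext s; simp [f]
    have hgx : ContDiff ℝ ∞ fun y => g (x + y) := hg.comp (by fun_prop)
    rw [this, ContinuousLinearMap.iteratedFDeriv_comp_right _ hgx _ (mod_cast le_top),
      iteratedFDeriv_comp_add_left]
    simp
  have key := taylor_integral_remainder (f := f) (x := 1) (x₀ := 0) (n := n)
    ((hf.of_le (mod_cast le_top)).contDiffOn)
  rw [sub_eq_iff_eq_add', taylor_within_apply] at key
  have h1 : f 1 = g (x + w) := by simp [f]
  rw [← h1, key]
  congr 1
  · refine Finset.sum_congr rfl fun l _ => ?_
    rw [hder l 0 (by simp)]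
    simp
  · refine intervalIntegral.integral_congr fun t ht => ?_
    rw [hder (n + 1) t ht]

/-- If all moments of `φ` vanish, then averaging `g` against `φ` only sees Taylor remainders. -/
theorem integral_mul_eq_integral_mul_taylor_remainder {d : ℕ} {φ : 𝓢(RD d, ℂ)}
    (hφ : ⇑(fourierS φ) =ᶠ[𝓝 0] 0) {g : RD d → ℂ} (hg : ContDiff ℝ ∞ g) {B : ℝ}
    (hB : ∀ y, ‖g y‖ ≤ B) (n : ℕ) (x : RD d) (r : ℝ) :
    ∫ w, φ w * g (x + r • w) = ∫ w, φ w * ∫ t in (0 : ℝ)..1, ((1 - t) ^ n / n.factorial) •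
      iteratedFDeriv ℝ (n + 1) g (x + t • r • w) (fun _ => r • w) := by
  let M : (l : ℕ) → ContinuousMultilinearMap ℝ (fun _ : Fin l => RD d) ℂ := fun l =>
    ((l.factorial : ℝ)⁻¹ • iteratedFDeriv ℝ l g x).compContinuousLinearMap
      (fun _ => r • ContinuousLinearMap.id ℝ (RD d))
  have hrem : ∀ w : RD d, φ w * (∫ t in (0 : ℝ)..1, ((1 - t) ^ n / n.factorial) •
      iteratedFDeriv ℝ (n + 1) g (x + t • r • w) (fun _ => r • w)) =
      φ w * g (x + r • w) - ∑ l ∈ Finset.range (n + 1), φ w * M l (fun _ => w) := by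
    intro w
    rw [taylor_segment hg n x (r • w), mul_add, Finset.mul_sum]
    simp [M]
  have hi : Integrable fun w => φ w * g (x + r • w) := by
    refine φ.integrable.mul_bdd (c := B) ?_ (ae_of_all _ fun w => hB _)
    exact (hg.continuous.comp (by fun_prop)).aestronglyMeasurable
  simp_rw [hrem]
  rw [integral_sub hi (integrable_finsetSum _ fun l _ => integrable_multilinear_mul φ (M l)),
    integral_finsetSum _ fun l _ => integrable_multilinear_mul φ (M l)]
  simp [integral_mul_multilinear_eq_zero hφ]

theorem integral_LPkernel_succ_mul {d : ℕ} (D : LPData d) (j : ℕ) (g : RD d → ℂ) (x : RD d) :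
    ∫ y, LPkernel D (j + 1) y * g (x - y) =
      ∫ w, D.φ w * g (x + (-((2 : ℝ) ^ (j + 1))⁻¹) • w) := by
  have h := Measure.integral_comp_smul volume
    (fun w => D.φ w * g (x + (-((2 : ℝ) ^ (j + 1))⁻¹) • w)) ((2 : ℝ) ^ (j + 1))
  have h2 : ((2 : ℝ) ^ (j + 1)) ≠ 0 := by positivity
  simp only [neg_smul, inv_smul_smul₀ h2, ← sub_eq_add_neg,
    finrank_euclideanSpace, Fintype.card_fin] at h
  simp only [LPkernel, mul_assoc, neg_smul, ← sub_eq_add_neg]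
  rw [integral_const_mul, h, abs_of_pos (by positivity), ← pow_mul, Complex.real_smul, ← mul_assoc,
    ← Complex.ofReal_mul, mul_inv_cancel₀ (by positivity), Complex.ofReal_one, one_mul]

namespace LPData

variable {d : ℕ} (D : LPData d)

theorem norm_mem_of_fourierS_ne_zero {ξ : RD d} (h : fourierS D.φ ξ ≠ 0) :
    1 / 2 < ‖ξ‖ ∧ ‖ξ‖ < 2 := by
  have hcont : Continuous fun t : ℝ => fourierS D.φ (t • ξ) :=
    (fourierS D.φ).continuous.comp (by fun_prop)
  have hev : ∀ᶠ t in nhds (1 : ℝ), fourierS D.φ (t • ξ) ≠ 0 :=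
    hcont.continuousAt.eventually_ne (by simpa using h)
  have hξ : 0 < ‖ξ‖ := by linarith [(D.supp_φ ξ h).1]
  constructor
  · have hnhds : Set.Ioo (0 : ℝ) 1 ∈ nhdsWithin 1 (Set.Iio 1) := Ioo_mem_nhdsLT one_pos
    obtain ⟨t, ht, ht0, ht1⟩ := ((hev.filter_mono nhdsWithin_le_nhds).and hnhds).exists
    have := (D.supp_φ _ ht).1
    rw [norm_smul, Real.norm_of_nonneg (le_of_lt ht0)] at this
    nlinarith
  · have hnhds : Set.Ioo (1 : ℝ) 2 ∈ nhdsWithin 1 (Set.Ioi 1) := Ioo_mem_nhdsGT one_lt_two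
    obtain ⟨t, ht, ht1, -⟩ := ((hev.filter_mono nhdsWithin_le_nhds).and hnhds).exists
    have := (D.supp_φ _ ht).2
    rw [norm_smul, Real.norm_of_nonneg (by linarith)] at this
    nlinarith

theorem fourierS_eventuallyEq_zero : ⇑(fourierS D.φ) =ᶠ[nhds 0] 0 := by
  filter_upwards [Metric.ball_mem_nhds (0 : RD d) (by norm_num : (0 : ℝ) < 1 / 2)] with ξ hξ
  by_contra h
  have := (D.norm_mem_of_fourierS_ne_zero h).1
  simp at hξ
  linarith

theorem fourierS_smul_eq_zero {ξ : RD d} {c : ℝ} (hc : 0 ≤ c)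
    (h : c * ‖ξ‖ ≤ 1 / 2 ∨ 2 ≤ c * ‖ξ‖) : fourierS D.φ (c • ξ) = 0 := by
  by_contra hne
  have := D.norm_mem_of_fourierS_ne_zero hne
  rw [norm_smul, Real.norm_of_nonneg hc] at this
  rcases h with h | h <;> linarith

theorem norm_lt_of_fourierS_Φ_ne_zero {ξ : RD d} (h : fourierS D.Φ ξ ≠ 0) : ‖ξ‖ < 2 := by
  by_contra! hξ
  refine h ?_
  have hne : ξ ≠ 0 := by
    rintro rfl
    simp at hξ
    linarith
  have hinj : Function.Injective fun n : ℕ => (n : ℤ) + 1 := fun a b hab => by simpa using hab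
  have hs := (hinj.hasSum_iff (f := fun k : ℤ => fourierS D.φ ((2 : ℝ) ^ (-k) • ξ)) (a := 1) ?_).2
    (D.sum_φ ξ hne)
  · rw [D.Φ_def, sub_eq_zero, ← hs.tsum_eq]
    refine tsum_congr fun n => ?_
    simp only [Function.comp, zpow_neg]
    norm_cast
  · intro k hk
    refine D.fourierS_smul_eq_zero (by positivity) (Or.inr ?_)
    have hk0 : 0 ≤ -k := by
      by_contra! hlt
      exact hk ⟨(k - 1).toNat, by simp only; omega⟩
    have : (1 : ℝ) ≤ 2 ^ (-k) := one_le_zpow₀ (by norm_num) hk0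
    nlinarith

theorem norm_lt_of_LPhat_ne_zero {k : ℕ} {ξ : RD d} (h : LPhat D k ξ ≠ 0) :
    ‖ξ‖ < 2 ^ (k + 1) := by
  cases k with
  | zero => simpa using D.norm_lt_of_fourierS_Φ_ne_zero h
  | succ k =>
    have := (D.norm_mem_of_fourierS_ne_zero h).2
    rw [norm_smul, norm_inv, Real.norm_of_nonneg (by positivity),
      inv_mul_lt_iff₀ (by positivity)] at this
    rwa [pow_succ _ (k + 1)]

theorem lt_norm_of_LPhat_succ_ne_zero {k : ℕ} {ξ : RD d} (h : LPhat D (k + 1) ξ ≠ 0) :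
    2 ^ k < ‖ξ‖ := by
  have := (D.norm_mem_of_fourierS_ne_zero h).1
  rw [norm_smul, norm_inv, Real.norm_of_nonneg (by positivity),
    lt_inv_mul_iff₀ (by positivity), pow_succ] at this
  linarith

/-- The multiplier of `Π*_k` equals `1` on the support of the multiplier of `Π_k`. -/
theorem LPhat_star_eq_one {k : ℕ} {ξ : RD d} (h : LPhat D k ξ ≠ 0) :
    (if k = 0 then 0 else LPhat D (k - 1) ξ) + LPhat D k ξ + LPhat D (k + 1) ξ = 1 := by
  have hup := D.norm_lt_of_LPhat_ne_zero h
  have htail : ∀ n, k + 1 ≤ n → fourierS D.φ (((2 : ℝ) ^ (n + 1))⁻¹ • ξ) = 0 := by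
    intro n hn
    refine D.fourierS_smul_eq_zero (by positivity) (Or.inl ?_)
    rw [inv_mul_le_iff₀ (by positivity), pow_succ]
    have : (2 : ℝ) ^ (k + 1) ≤ 2 ^ n := pow_le_pow_right₀ (by norm_num) hn
    linarith
  have htsum : ∑' n : ℕ, fourierS D.φ (((2 : ℝ) ^ (n + 1))⁻¹ • ξ) =
      ∑ n ∈ Finset.range (k + 1), fourierS D.φ (((2 : ℝ) ^ (n + 1))⁻¹ • ξ) :=
    tsum_eq_sum fun n hn => htail n (by simpa using hn)
  match k with
  | 0 => simp [LPhat, D.Φ_def, htsum]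
  | 1 =>
    simp [LPhat, D.Φ_def, htsum, Finset.sum_range_succ]
    ring
  | l + 2 =>
    have hlow := D.lt_norm_of_LPhat_succ_ne_zero h
    have hne : ξ ≠ 0 := by
      rintro rfl
      simp only [norm_zero] at hlow
      exact absurd hlow (not_lt.2 (by positivity))
    have hz : ∀ n : ℤ, n ∉ ({(l : ℤ) + 1, (l : ℤ) + 2, (l : ℤ) + 3} : Finset ℤ) →
        fourierS D.φ ((2 : ℝ) ^ (-n) • ξ) = 0 := by
      intro n hn
      simp only [Finset.mem_insert, Finset.mem_singleton, not_or] at hn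
      refine D.fourierS_smul_eq_zero (by positivity) ?_
      rcases lt_or_ge n ((l : ℤ) + 1) with h1 | h1
      · right
        have : (2 : ℝ) ^ (-(l : ℤ)) ≤ 2 ^ (-n) := zpow_le_zpow_right₀ (by norm_num) (by omega)
        calc (2 : ℝ) = 2 ^ (-(l : ℤ)) * 2 ^ (l + 1) := by
              rw [zpow_neg, zpow_natCast, pow_succ, inv_mul_cancel_left₀ (by positivity)]
          _ ≤ _ := by gcongr
      · left
        have : (2 : ℝ) ^ (-n) ≤ 2 ^ (-((l : ℤ) + 4)) :=
          zpow_le_zpow_right₀ (by norm_num) (by omega)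
        calc _ ≤ (2 : ℝ) ^ (-((l : ℤ) + 4)) * 2 ^ (l + 2 + 1) := by gcongr
          _ = 1 / 2 := by
            rw [zpow_neg]
            norm_cast
            rw [inv_mul_eq_div, div_eq_div_iff (by positivity) (by positivity)]
            push_cast
            ring
    have := (hasSum_sum_of_ne_finset_zero hz).unique (D.sum_φ ξ hne)
    rw [Finset.sum_insert (by simp), Finset.sum_insert (by simp), Finset.sum_singleton] at this
    rw [← this]
    simp only [LPhat, zpow_neg, Nat.add_eq_zero_iff, OfNat.ofNat_ne_zero, and_false, if_false,
      show l + 2 - 1 = l + 1 from rfl]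
    norm_cast
    ring

end LPData

theorem fourier_comp_smul {d : ℕ} (f : RD d → ℂ) {R : ℝ} (hR : 0 < R) (ξ : RD d) :
    𝓕 (fun v => f (R • v)) ξ = ((R ^ d)⁻¹ : ℝ) • 𝓕 f (R⁻¹ • ξ) := by
  have h := Measure.integral_comp_smul volume
    (fun w => Real.fourierChar (-⟪w, R⁻¹ • ξ⟫) • f w) R
  simp only [real_inner_smul_left, real_inner_smul_right, inv_mul_cancel_left₀ hR.ne',
    finrank_euclideanSpace, Fintype.card_fin] at h
  rw [Real.fourier_eq, Real.fourier_eq, h, abs_of_pos (by positivity)]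
  simp only [real_inner_smul_right]

theorem integrable_LPkernel {d : ℕ} (D : LPData d) (k : ℕ) : Integrable (LPkernel D k) := by
  cases k with
  | zero => exact D.Φ.integrable
  | succ k => exact (D.φ.integrable.comp_smul (by positivity)).const_mul _

theorem fourier_LPkernel {d : ℕ} (D : LPData d) (k : ℕ) (ξ : RD d) :
    𝓕 (LPkernel D k) ξ = LPhat D k ξ := by
  cases k with
  | zero => rfl
  | succ k =>
    have h := fourier_comp_smul (⇑D.φ) (R := 2 ^ (k + 1)) (by positivity) ξ
    have h2 : 𝓕 (LPkernel D (k + 1)) ξ =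
        (((2 : ℝ) ^ ((k + 1) * d) : ℝ) : ℂ) * 𝓕 (fun v => D.φ ((2 : ℝ) ^ (k + 1) • v)) ξ := by
      rw [Real.fourier_eq, Real.fourier_eq, ← integral_const_mul]
      refine integral_congr_ae (ae_of_all _ fun v => ?_)
      simp only [LPkernel, Circle.smul_def, smul_eq_mul]
      ring
    rw [h2, h, ← pow_mul, Complex.real_smul, ← mul_assoc, ← Complex.ofReal_mul,
      mul_inv_cancel₀ (by positivity), Complex.ofReal_one, one_mul]
    rfl

open scoped Convolution in
theorem LP_eq_convolution {d : ℕ} (D : LPData d) (k : ℕ) (g : RD d → ℂ) :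
    LP D k g = LPkernel D k ⋆[ContinuousLinearMap.mul ℂ ℂ] g := rfl

theorem integrable_LP {d : ℕ} (D : LPData d) (k : ℕ) (f : 𝓢(RD d, ℂ)) : Integrable (LP D k f) := by
  rw [LP_eq_convolution]
  exact (integrable_LPkernel D k).integrable_convolution _ f.integrable

theorem fourier_LP {d : ℕ} (D : LPData d) (k : ℕ) (f : 𝓢(RD d, ℂ)) (ξ : RD d) :
    𝓕 (LP D k f) ξ = LPhat D k ξ * fourierS f ξ := by
  rw [LP_eq_convolution, Real.fourier_mul_convolution_eq (integrable_LPkernel D k) f.integrable,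
    fourier_LPkernel]
  rfl

theorem fourier_fun_add {d : ℕ} {f g : RD d → ℂ} (hf : Integrable f) (hg : Integrable g)
    (ξ : RD d) : 𝓕 (fun x => f x + g x) ξ = 𝓕 f ξ + 𝓕 g ξ := by
  simp only [Real.fourier_eq, smul_add]
  exact integral_add ((Real.fourierIntegral_convergent_iff ξ).2 hf)
    ((Real.fourierIntegral_convergent_iff ξ).2 hg)

theorem integrable_LPstar {d : ℕ} (D : LPData d) (k : ℕ) (f : 𝓢(RD d, ℂ)) :
    Integrable (LPstar D k f) := by
  unfold LPstar
  refine (Integrable.add ?_ (integrable_LP D k f)).add (integrable_LP D (k + 1) f)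
  split_ifs
  · exact integrable_zero _ _ _
  · exact integrable_LP D (k - 1) f

theorem fourier_LPstar {d : ℕ} (D : LPData d) (k : ℕ) (f : 𝓢(RD d, ℂ)) (ξ : RD d) :
    𝓕 (LPstar D k f) ξ = ((if k = 0 then 0 else LPhat D (k - 1) ξ) + LPhat D k ξ +
      LPhat D (k + 1) ξ) * fourierS f ξ := by
  unfold LPstar
  have h := integrable_LP D k f
  have h' := integrable_LP D (k + 1) f
  split_ifs with hk
  · rw [fourier_fun_add (by simpa using h) h']
    simp only [zero_add, add_mul]
    rw [← fourier_LP, ← fourier_LP]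
  · have h'' := integrable_LP D (k - 1) f
    rw [fourier_fun_add (f := fun x => LP D (k - 1) f x + LP D k f x) (h''.add h) h',
      fourier_fun_add h'' h]
    simp only [fourier_LP]
    ring

/-- Fourier-side integrals against `𝓕 g` as a convolution of `g`. -/
theorem integral_mul_fourier_mul_exp {d : ℕ} {g q : RD d → ℂ} (hg : Integrable g)
    (hq : Integrable q) (x : RD d) :
    ∫ ξ, q ξ * 𝓕 g ξ * Complex.exp (2 * Real.pi * Complex.I * ((⟪x, ξ⟫ : ℝ) : ℂ)) =
      ∫ z, g (x - z) * 𝓕 q (-z) := by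
  have hq' : Integrable fun ξ => Real.fourierChar (-⟪ξ, -x⟫) • q ξ :=
    (Real.fourierIntegral_convergent_iff (-x)).2 hq
  have h := VectorFourier.integral_fourierIntegral_smul_eq_flip (L := innerₗ (RD d))
    Real.continuous_fourierChar continuous_inner hg hq'
  have h1 : ∀ ξ, q ξ * 𝓕 g ξ * Complex.exp (2 * Real.pi * Complex.I * ((⟪x, ξ⟫ : ℝ) : ℂ)) =
      VectorFourier.fourierIntegral Real.fourierChar volume (innerₗ (RD d)) g ξ •
        (Real.fourierChar (-⟪ξ, -x⟫) • q ξ) := by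
    intro ξ
    have : 𝓕 g ξ = VectorFourier.fourierIntegral Real.fourierChar volume (innerₗ (RD d)) g ξ := rfl
    rw [← this, Circle.smul_def, Real.fourierChar_apply, inner_neg_right, neg_neg,
      real_inner_comm]
    simp only [smul_eq_mul]
    push_cast
    ring_nf
  simp_rw [h1]
  rw [h, ← integral_sub_left_eq_self _ volume x]
  refine integral_congr_ae (ae_of_all _ fun z => ?_)
  simp only [smul_eq_mul]
  congr 1
  rw [Real.fourier_eq, VectorFourier.fourierIntegral]
  refine integral_congr_ae (ae_of_all _ fun ξ => ?_)
  simp only [smul_smul, ← AddChar.map_add_eq_mul]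
  congr 2
  simp [inner_sub_right]

theorem enorm_le_peetre_mul {d : ℕ} (σ : ℝ) {R : ℝ} (hR : 0 ≤ R) (g : RD d → ℂ) (x z : RD d) :
    ‖g (x - z)‖ₑ ≤ peetre σ R g x * ENNReal.ofReal ((1 + R * ‖z‖) ^ σ) := by
  have hpos : 0 < (1 + R * ‖z‖) ^ σ := by positivity
  rw [← ENNReal.div_le_iff (by simpa using hpos) ENNReal.ofReal_ne_top]
  exact le_iSup (fun y : RD d => (‖g (x - y)‖₊ : ℝ≥0∞) / ENNReal.ofReal ((1 + R * ‖y‖) ^ σ)) z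

theorem fourier_decay_of_contDiff {d : ℕ} (n : ℕ) : ∃ C : ℝ, 0 ≤ C ∧ ∀ (h : RD d → ℂ) (A : ℝ),
    ContDiff ℝ ∞ h → tsupport h ⊆ Metric.closedBall 0 2 →
    (∀ i ≤ n, ∀ η, ‖iteratedFDeriv ℝ i h η‖ ≤ A) →
    ∀ z, (1 + ‖z‖) ^ n * ‖𝓕 h z‖ ≤ C * A := by
  set V : ℝ := volume.real (Metric.closedBall (0 : RD d) 2)
  refine ⟨2 ^ (n - 1) * (V + 2 ^ n * ((n + 1) * V)), by positivity, fun h A hh hs hA z => ?_⟩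
  have hc : HasCompactSupport h :=
    (isCompact_closedBall _ _).of_isClosed_subset (isClosed_tsupport _) hs
  have hcont : ∀ i, Continuous fun v => ‖iteratedFDeriv ℝ i h v‖ := fun i =>
    (hh.continuous_iteratedFDeriv (mod_cast le_top)).norm
  have hint : ∀ i, Integrable fun v => ‖iteratedFDeriv ℝ i h v‖ := fun i =>
    (hcont i).integrable_of_hasCompactSupport (hc.iteratedFDeriv i).norm
  have hle : ∀ i ≤ n, ∫ v, ‖iteratedFDeriv ℝ i h v‖ ≤ V * A := by
    intro i hi
    have hz : ∀ v ∉ Metric.closedBall (0 : RD d) 2, ‖iteratedFDeriv ℝ i h v‖ = 0 := by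
      intro v hv
      by_contra hne
      exact hv (hs (support_iteratedFDeriv_subset i (by simpa using hne)))
    rw [← setIntegral_eq_integral_of_forall_compl_eq_zero hz]
    calc _ ≤ ∫ _ in Metric.closedBall (0 : RD d) 2, A :=
          integral_mono_of_nonneg (ae_of_all _ fun _ => norm_nonneg _)
            (integrableOn_const (measure_closedBall_lt_top.ne)) (ae_of_all _ fun v => hA i hi v)
      _ = V * A := by simp [V]
  have hint' : ∀ j i : ℕ, (j : ℕ∞) ≤ (0 : ℕ∞) → (i : ℕ∞) ≤ (⊤ : ℕ∞) →
      Integrable (fun v ↦ ‖v‖ ^ j * ‖iteratedFDeriv ℝ i h v‖) := by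
    intro j i hj _
    obtain rfl : j = 0 := by simpa using hj
    simpa using hint i
  have hbound : ∀ l, l ≤ n → ‖z‖ ^ l * ‖𝓕 h z‖ ≤ 2 ^ l * ((l + 1) * (V * A)) := by
    intro l hl
    have := Real.pow_mul_norm_iteratedFDeriv_fourier_le (K := 0) (N := ⊤) (k := 0) (n := l)
      (by exact_mod_cast hh) hint' (by simp) le_top z
    rw [norm_iteratedFDeriv_zero] at this
    refine this.trans ?_
    simp only [pow_zero, one_mul, CharP.cast_eq_zero, mul_zero, zero_add, Finset.range_one,
      Finset.singleton_product, Finset.sum_map, Function.Embedding.coeFn_mk]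
    gcongr
    calc _ ≤ ∑ _i ∈ Finset.range (l + 1), V * A := Finset.sum_le_sum fun i hi => by
          simpa using hle i (by simp at hi; omega)
      _ = _ := by simp
  have h0 : ‖𝓕 h z‖ ≤ V * A := by simpa using hbound 0 (Nat.zero_le _)
  have hn := hbound n le_rfl
  calc (1 + ‖z‖) ^ n * ‖𝓕 h z‖ ≤ 2 ^ (n - 1) * (1 ^ n + ‖z‖ ^ n) * ‖𝓕 h z‖ := by
        gcongr
        exact add_pow_le zero_le_one (norm_nonneg _) n
    _ = 2 ^ (n - 1) * (‖𝓕 h z‖ + ‖z‖ ^ n * ‖𝓕 h z‖) := by ring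
    _ ≤ 2 ^ (n - 1) * (V * A + 2 ^ n * ((n + 1) * (V * A))) := by gcongr
    _ = _ := by ring

/-- The unscaled multiplier `φ̂` (or `Φ̂` for `k = 0`) of which `LPhat D k` is a dilate. -/
def LPprofile {d : ℕ} (D : LPData d) : ℕ → 𝓢(RD d, ℂ)
  | 0 => fourierS D.Φ
  | _ + 1 => fourierS D.φ

theorem LPhat_eq_LPprofile {d : ℕ} (D : LPData d) (k : ℕ) (ξ : RD d) :
    LPhat D k ξ = LPprofile D k (((2 : ℝ) ^ k)⁻¹ • ξ) := by
  cases k with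
  | zero => simp [LPhat, LPprofile]
  | succ k => rfl

theorem norm_of_mem_tsupport_LPprofile {d : ℕ} (D : LPData d) {k : ℕ} {η : RD d}
    (h : η ∈ tsupport (LPprofile D k)) : ‖η‖ ≤ 2 ∧ (k = 0 ∨ 1 / 2 ≤ ‖η‖) := by
  cases k with
  | zero =>
    refine ⟨?_, Or.inl rfl⟩
    have : tsupport (LPprofile D 0) ⊆ {η | ‖η‖ ≤ 2} :=
      closure_minimal (fun η hη => (D.norm_lt_of_fourierS_Φ_ne_zero hη).le)
        (isClosed_le continuous_norm continuous_const)
    exact this h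
  | succ k =>
    have : tsupport (LPprofile D (k + 1)) ⊆ {η | ‖η‖ ≤ 2} ∩ {η | 1 / 2 ≤ ‖η‖} :=
      closure_minimal (fun η hη => ⟨(D.supp_φ η hη).2, (D.supp_φ η hη).1⟩)
        ((isClosed_le continuous_norm continuous_const).inter
          (isClosed_le continuous_const continuous_norm))
    exact ⟨(this h).1, Or.inr (this h).2⟩

theorem exists_iteratedFDeriv_LPprofile_le {d : ℕ} (D : LPData d) (n : ℕ) :
    ∃ c : ℝ, 0 ≤ c ∧ ∀ k, ∀ i ≤ n, ∀ η, ‖iteratedFDeriv ℝ i (LPprofile D k) η‖ ≤ c := by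
  have key : ∀ ψ : 𝓢(RD d, ℂ), ∃ c : ℝ, 0 ≤ c ∧ ∀ i ≤ n, ∀ η, ‖iteratedFDeriv ℝ i ψ η‖ ≤ c := by
    intro ψ
    choose C hC hC' using fun i => ψ.decay 0 i
    refine ⟨∑ i ∈ Finset.range (n + 1), C i, Finset.sum_nonneg fun i _ => (hC i).le,
      fun i hi η => ?_⟩
    calc _ ≤ C i := by simpa using hC' i η
      _ ≤ _ := Finset.single_le_sum (fun i _ => (hC i).le) (by simp; omega)
  obtain ⟨c₀, h₀, h₀'⟩ := key (fourierS D.Φ)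
  obtain ⟨c₁, h₁, h₁'⟩ := key (fourierS D.φ)
  refine ⟨c₀ + c₁, by positivity, fun k i hi η => ?_⟩
  cases k with
  | zero => exact (h₀' i hi η).trans (by linarith)
  | succ k => exact (h₁' i hi η).trans (by linarith)

theorem one_add_mul_rpow_le {k : ℕ} {r : ℝ} (hr : 0 ≤ r) (h2 : r ≤ 2) (h : k = 0 ∨ 1 / 2 ≤ r)
    (s : ℝ) : (1 + 2 ^ k * r) ^ s ≤ 4 ^ |s| * (2 : ℝ) ^ (k * s) := by
  have hk : (1 : ℝ) ≤ 2 ^ k := one_le_pow₀ (by norm_num)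
  have hk0 : (0 : ℝ) < 2 ^ k := by positivity
  set τ : ℝ := (1 + 2 ^ k * r) / 2 ^ k
  have hτ : 1 + 2 ^ k * r = 2 ^ k * τ := by
    simp only [τ]; field_simp
  have hτ4 : τ ≤ 4 := by
    rw [div_le_iff₀ hk0]; nlinarith
  have hτ2 : 1 / 4 ≤ τ := by
    rw [le_div_iff₀ hk0]
    rcases h with rfl | h
    · norm_num; linarith
    · nlinarith
  have hτ0 : 0 < τ := by linarith
  rw [hτ, Real.mul_rpow hk0.le hτ0.le, mul_comm, ← Real.rpow_natCast 2 k,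
    ← Real.rpow_mul (by norm_num)]
  gcongr
  rcases le_total 0 s with hs | hs
  · rw [abs_of_nonneg hs]
    exact Real.rpow_le_rpow hτ0.le hτ4 hs
  · rw [abs_of_nonpos hs]
    calc τ ^ s ≤ (1 / 4) ^ s := Real.rpow_le_rpow_of_nonpos (by norm_num) hτ2 hs
      _ = 4 ^ (-s) := by rw [one_div, Real.inv_rpow (by norm_num), Real.rpow_neg (by norm_num)]

/-- Bounds on the derivatives of a symbol localized to frequency `2^k` and rescaled to unit size. -/
theorem exists_iteratedFDeriv_localized_le {d : ℕ} (D : LPData d) (μ : ℝ) (n : ℕ) :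
    ∃ K : ℝ, 0 ≤ K ∧ ∀ (k : ℕ) (p : RD d → ℂ) (B : ℝ), 0 ≤ B → ContDiff ℝ ∞ p →
      (∀ i ≤ n, ∀ ξ, ‖iteratedFDeriv ℝ i p ξ‖ ≤ B * (1 + ‖ξ‖) ^ (μ - i)) →
      ∀ i ≤ n, ∀ η, ‖iteratedFDeriv ℝ i (fun η => p ((2 : ℝ) ^ k • η) * LPprofile D k η) η‖ ≤
        K * (B * 2 ^ (k * μ)) := by
  obtain ⟨c, hc, hc'⟩ := exists_iteratedFDeriv_LPprofile_le D n
  refine ⟨2 ^ n * (4 ^ (|μ| + n) * c), by positivity, fun k p B hB hp hpB i hi η => ?_⟩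
  by_cases hη : η ∈ tsupport (LPprofile D k)
  swap
  · have : iteratedFDeriv ℝ i (fun η => p ((2 : ℝ) ^ k • η) * LPprofile D k η) η = 0 := by
      by_contra hne
      exact hη (tsupport_mul_subset_right (support_iteratedFDeriv_subset i hne))
    rw [this, norm_zero]
    positivity
  obtain ⟨h2, hlow⟩ := norm_of_mem_tsupport_LPprofile D hη
  have hp' : ContDiff ℝ ∞ fun η => p ((2 : ℝ) ^ k • η) := hp.comp (by fun_prop)
  have hpi : ∀ l ≤ n, ‖iteratedFDeriv ℝ l (fun η => p ((2 : ℝ) ^ k • η)) η‖ ≤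
      4 ^ (|μ| + n) * (B * 2 ^ (k * μ)) := by
    intro l hl
    rw [iteratedFDeriv_comp_const_smul _ (hp.of_le (mod_cast le_top)), norm_smul, norm_pow,
      Real.norm_of_nonneg (by positivity)]
    have h1 := hpB l hl ((2 : ℝ) ^ k • η)
    rw [norm_smul, Real.norm_of_nonneg (by positivity)] at h1
    have h3 := one_add_mul_rpow_le (norm_nonneg η) h2 hlow (μ - l)
    have h4 : |μ - l| ≤ |μ| + n := (abs_sub _ _).trans (by
      rw [Nat.abs_cast]; gcongr)
    have h5 : ((2 : ℝ) ^ k) ^ l * 2 ^ (k * (μ - l)) = 2 ^ (k * μ) := by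
      rw [← pow_mul, ← Real.rpow_natCast, ← Real.rpow_add (by norm_num)]
      congr 1
      push_cast
      ring
    calc ((2 : ℝ) ^ k) ^ l * ‖iteratedFDeriv ℝ l p ((2 : ℝ) ^ k • η)‖
        ≤ ((2 : ℝ) ^ k) ^ l * (B * (4 ^ (|μ| + n) * 2 ^ (k * (μ - l)))) := by
          gcongr
          refine h1.trans ?_
          gcongr
          refine h3.trans ?_
          gcongr
          norm_num
      _ = 4 ^ (|μ| + n) * (B * (((2 : ℝ) ^ k) ^ l * 2 ^ (k * (μ - l)))) := by ring
      _ = _ := by rw [h5]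
  refine (norm_iteratedFDeriv_mul_le hp' ((LPprofile D k).smooth ⊤) η (mod_cast le_top)).trans ?_
  calc _ ≤ ∑ l ∈ Finset.range (i + 1),
        (i.choose l : ℝ) * (4 ^ (|μ| + n) * (B * 2 ^ (k * μ))) * c := by
        refine Finset.sum_le_sum fun l hl => ?_
        have hl' : l ≤ i := by simp at hl; omega
        have := hpi l (hl'.trans hi)
        have := hc' k (i - l) ((Nat.sub_le _ _).trans hi) η
        gcongr
    _ = 2 ^ i * (4 ^ (|μ| + n) * (B * 2 ^ (k * μ)) * c) := by
        simp_rw [mul_assoc]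
        rw [← Finset.sum_mul]
        norm_cast
        rw [Nat.sum_range_choose]
    _ ≤ 2 ^ n * (4 ^ (|μ| + n) * (B * 2 ^ (k * μ)) * c) := by
        gcongr
        norm_num
    _ = _ := by ring

/-- A frequency-localized Fourier multiplier is controlled by the Peetre maximal function. -/
theorem exists_enorm_multiplier_le {d : ℕ} (D : LPData d) (μ σ : ℝ) (n : ℕ) (hn : d + σ < n) :
    ∃ C : ℝ≥0, ∀ (k : ℕ) (p : RD d → ℂ) (B : ℝ), 0 ≤ B → ContDiff ℝ ∞ p →
      (∀ i ≤ n, ∀ ξ, ‖iteratedFDeriv ℝ i p ξ‖ ≤ B * (1 + ‖ξ‖) ^ (μ - i)) →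
      ∀ (g : RD d → ℂ), Integrable g → ∀ x : RD d,
      ‖∫ ξ, p ξ * LPhat D k ξ * 𝓕 g ξ *
          Complex.exp (2 * Real.pi * Complex.I * ((⟪x, ξ⟫ : ℝ) : ℂ))‖ₑ ≤
        C * ENNReal.ofReal (B * 2 ^ (k * μ)) * peetre σ (2 ^ k) g x := by
  obtain ⟨K, hK, hK'⟩ := exists_iteratedFDeriv_localized_le D μ n
  obtain ⟨C, hC, hC'⟩ := fourier_decay_of_contDiff (d := d) n
  have hJint : Integrable fun z : RD d => (1 + ‖z‖) ^ (-(n - σ)) :=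
    integrable_one_add_norm (by simp; linarith)
  set J : ℝ := ∫ z : RD d, (1 + ‖z‖) ^ (-(n - σ))
  have hJ : 0 ≤ J := integral_nonneg fun z => by positivity
  refine ⟨(C * K * J).toNNReal, fun k p B hB hp hpB g hg x => ?_⟩
  set R : ℝ := 2 ^ k
  have hR : 0 < R := by positivity
  set A : ℝ := K * (B * 2 ^ (k * μ))
  set h : RD d → ℂ := fun η => p (R • η) * LPprofile D k η
  have hsupp : tsupport h ⊆ Metric.closedBall 0 2 := fun η hη => by
    simpa using (norm_of_mem_tsupport_LPprofile D (tsupport_mul_subset_right hη)).1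
  have hh : ContDiff ℝ ∞ h := (hp.comp (by fun_prop)).mul ((LPprofile D k).smooth ⊤)
  have hcs : HasCompactSupport h :=
    (isCompact_closedBall _ _).of_isClosed_subset (isClosed_tsupport _) hsupp
  have hq : (fun ξ => p ξ * LPhat D k ξ) = fun ξ => h (R⁻¹ • ξ) := by
    funext ξ
    simp only [h, LPhat_eq_LPprofile, smul_inv_smul₀ hR.ne', R]
  have hqint : Integrable fun ξ => p ξ * LPhat D k ξ := by
    rw [hq]
    exact (hh.continuous.integrable_of_hasCompactSupport hcs).comp_smul (by positivity)
  have hdecay : ∀ z, ‖𝓕 (fun ξ => p ξ * LPhat D k ξ) (-z)‖ ≤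
      R ^ d * (C * A * ((1 + R * ‖z‖) ^ n)⁻¹) := by
    intro z
    rw [hq, fourier_comp_smul h (inv_pos.2 hR), norm_smul, inv_inv, inv_pow, inv_inv,
      Real.norm_of_nonneg (by positivity)]
    gcongr
    rw [← div_eq_mul_inv, le_div_iff₀ (by positivity)]
    have := hC' h A hh hsupp (hK' k p B hB hp hpB) (R • -z)
    rw [norm_smul, norm_neg, Real.norm_of_nonneg hR.le] at this
    linarith
  rw [integral_mul_fourier_mul_exp hg hqint]
  have hscale : ∫ z : RD d, R ^ d * (1 + ‖R • z‖) ^ (-(n - σ)) = J := by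
    rw [integral_const_mul,
      Measure.integral_comp_smul volume (fun z : RD d => (1 + ‖z‖) ^ (-(n - σ))),
      finrank_euclideanSpace, Fintype.card_fin, abs_of_pos (by positivity), smul_eq_mul,
      mul_inv_cancel_left₀ (by positivity)]
  have hA : 0 ≤ A := by positivity
  calc ‖∫ z, g (x - z) * 𝓕 (fun ξ => p ξ * LPhat D k ξ) (-z)‖ₑ
      ≤ ∫⁻ z, ‖g (x - z) * 𝓕 (fun ξ => p ξ * LPhat D k ξ) (-z)‖ₑ :=
        enorm_integral_le_lintegral_enorm _
    _ ≤ ∫⁻ z, peetre σ R g x * ENNReal.ofReal (C * A * (R ^ d * (1 + ‖R • z‖) ^ (-(n - σ)))) := by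
        refine lintegral_mono fun z => ?_
        have hpos : 0 < 1 + R * ‖z‖ := by positivity
        have hz : C * A * (R ^ d * (1 + ‖R • z‖) ^ (-(n - σ))) =
            (1 + R * ‖z‖) ^ σ * (R ^ d * (C * A * ((1 + R * ‖z‖) ^ n)⁻¹)) := by
          rw [norm_smul, Real.norm_of_nonneg hR.le, neg_sub, Real.rpow_sub hpos, Real.rpow_natCast]
          ring
        simp only
        rw [enorm_mul, hz, ENNReal.ofReal_mul (by positivity), ← mul_assoc]
        gcongr
        · exact enorm_le_peetre_mul σ hR.le g x z
        · rw [← ofReal_norm]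
          exact ENNReal.ofReal_le_ofReal (hdecay z)
    _ = peetre σ R g x * ENNReal.ofReal (C * A * J) := by
        rw [lintegral_const_mul _ (by fun_prop), ← ofReal_integral_eq_lintegral_ofReal,
          integral_const_mul, hscale]
        · exact ((hJint.comp_smul hR.ne').const_mul _).const_mul _
        · exact ae_of_all _ fun z => by positivity
    _ = _ := by
        rw [mul_comm (peetre σ R g x)]
        change _ = ENNReal.ofReal (C * K * J) * _ * _
        rw [← ENNReal.ofReal_mul (by positivity)]
        congr 2
        simp only [A]
        ring

theorem contDiff_iteratedFDeriv_left {E F G : Type*} [NormedAddCommGroup E] [NormedSpace ℝ E]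
    [NormedAddCommGroup F] [NormedSpace ℝ F] [NormedAddCommGroup G] [NormedSpace ℝ G]
    {a : E → F → G} (ha : ContDiff ℝ ∞ fun p : E × F => a p.1 p.2) (n : ℕ) :
    ContDiff ℝ ∞ fun p : E × F => iteratedFDeriv ℝ n (fun x => a x p.2) p.1 := by
  have key (p : E × F) : iteratedFDeriv ℝ n (fun x => a x p.2) p.1 =
      ContinuousMultilinearMap.compContinuousLinearMapL
        (fun _ : Fin n => ContinuousLinearMap.inl ℝ E F)
        (iteratedFDeriv ℝ n (fun q : E × F => a q.1 q.2) p) := by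
    have hshift : ContDiff ℝ ∞ fun q : E × F => (fun q : E × F => a q.1 q.2) (q + (0, p.2)) :=
      ha.comp (by fun_prop)
    have h := (ContinuousLinearMap.inl ℝ E F).iteratedFDeriv_comp_right hshift p.1
      (i := n) (by exact_mod_cast le_top)
    rw [iteratedFDeriv_comp_add_right (f := fun q : E × F => a q.1 q.2)] at h
    simpa [Function.comp_def] using h
  simp_rw [key]
  exact (ContinuousLinearMap.contDiff _).comp
    (ha.iteratedFDeriv_right (m := ∞) (by exact_mod_cast le_top))

namespace IsSymbolS11

variable {d : ℕ} {m : ℝ} {a : RD d → RD d → ℂ}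

theorem contDiff_left (ha : IsSymbolS11 d m a) (ξ : RD d) : ContDiff ℝ ∞ fun x => a x ξ :=
  ha.1.comp (contDiff_id.prodMk contDiff_const)

theorem contDiff_iteratedFDeriv_apply (ha : IsSymbolS11 d m a) (n : ℕ) (u v : RD d) :
    ContDiff ℝ ∞ fun ξ => iteratedFDeriv ℝ n (fun x => a x ξ) u fun _ => v :=
  (ContinuousMultilinearMap.apply ℝ (fun _ : Fin n => RD d) ℂ fun _ => v).contDiff.comp
    ((contDiff_iteratedFDeriv_left ha.1 n).comp (contDiff_const.prodMk contDiff_id))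

theorem norm_le (ha : IsSymbolS11 d m a) (ξ : RD d) : ∃ B, ∀ x, ‖a x ξ‖ ≤ B := by
  obtain ⟨c, hc⟩ := ha.2 0 0
  exact ⟨_, fun x => by simpa only [norm_iteratedFDeriv_zero] using hc x ξ⟩

/-- The frequency derivatives, up to a fixed order, of a spatial derivative of a symbol. -/
theorem exists_iteratedFDeriv_le (ha : IsSymbolS11 d m a) (L n : ℕ) :
    ∃ B : ℝ, 0 ≤ B ∧ ∀ (u v : RD d), ∀ i ≤ n, ∀ ξ,
      ‖iteratedFDeriv ℝ i (fun ξ => iteratedFDeriv ℝ L (fun x => a x ξ) u fun _ => v) ξ‖ ≤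
        B * ‖v‖ ^ L * (1 + ‖ξ‖) ^ (m + L - i) := by
  choose c hc using fun i => ha.2 i L
  refine ⟨∑ i ∈ Finset.range (n + 1), |c i|, by positivity, fun u v i hi ξ => ?_⟩
  set A := ContinuousMultilinearMap.apply ℝ (fun _ : Fin L => RD d) ℂ fun _ => v
  have hA : ‖A‖ ≤ ‖v‖ ^ L := A.opNorm_le_bound (by positivity) fun M => by
    have := M.le_opNorm fun _ => v
    simpa [A, mul_comm] using this
  have hsmooth : ContDiff ℝ ∞ fun ξ => iteratedFDeriv ℝ L (fun x => a x ξ) u :=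
    (contDiff_iteratedFDeriv_left ha.1 L).comp (contDiff_const.prodMk contDiff_id)
  calc _ ≤ ‖A‖ * ‖iteratedFDeriv ℝ i (fun ξ => iteratedFDeriv ℝ L (fun x => a x ξ) u) ξ‖ :=
        A.norm_iteratedFDeriv_comp_left hsmooth.contDiffAt (by exact_mod_cast le_top)
    _ ≤ ‖v‖ ^ L * ((∑ i ∈ Finset.range (n + 1), |c i|) * (1 + ‖ξ‖) ^ (m - i + L)) := by
        gcongr
        refine (hc i u ξ).trans ?_
        gcongr
        exact (le_abs_self _).trans (Finset.single_le_sum (f := fun i => |c i|)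
          (fun _ _ => abs_nonneg _) (Finset.mem_range.2 (by omega)))
    _ = _ := by
        rw [show m - i + L = m + L - i by ring]
        ring

end IsSymbolS11

theorem continuous_LPhat {d : ℕ} (D : LPData d) (k : ℕ) : Continuous (LPhat D k) := by
  rw [funext (LPhat_eq_LPprofile D k)]
  exact (LPprofile D k).continuous.comp (by fun_prop)

theorem hasCompactSupport_LPhat {d : ℕ} (D : LPData d) (k : ℕ) :
    HasCompactSupport (LPhat D k) :=
  HasCompactSupport.intro (isCompact_closedBall 0 (2 ^ (k + 1))) fun ξ hξ => by
    by_contra h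
    exact hξ (by simpa using (D.norm_lt_of_LPhat_ne_zero h).le)

theorem LPhat_mul_fourier_LPstar {d : ℕ} (D : LPData d) (k : ℕ) (f : 𝓢(RD d, ℂ)) (ξ : RD d) :
    LPhat D k ξ * 𝓕 (LPstar D k f) ξ = LPhat D k ξ * fourierS f ξ := by
  by_cases h : LPhat D k ξ = 0
  · simp [h]
  · rw [fourier_LPstar, D.LPhat_star_eq_one h, one_mul]

theorem ae_norm_taylor_weight_le_one {α : Type*} [MeasurableSpace α] {μ : Measure α} [SFinite μ]
    (n : ℕ) : ∀ᵐ z : α × ℝ ∂(μ.prod (volume.restrict (Set.Ioc 0 1))),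
      ‖(((1 - z.2) ^ n / n.factorial : ℝ) : ℂ)‖ ≤ 1 := by
  filter_upwards [Measure.quasiMeasurePreserving_snd.ae
    (ae_restrict_mem (μ := volume) (measurableSet_Ioc (a := (0 : ℝ)) (b := 1)))] with z hz
  obtain ⟨h0, h1⟩ := hz
  have hn : (1 : ℝ) ≤ n.factorial := by exact_mod_cast n.factorial_pos
  rw [norm_real, Real.norm_of_nonneg (div_nonneg (pow_nonneg (by linarith) _) (by positivity))]
  exact div_le_one_of_le₀ ((pow_le_one₀ (by linarith) (by linarith)).trans hn) (by positivity)

/-- Taylor's formula in `x` turns `T_{a_{j,k}}` into an average of Fourier multipliers. -/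
theorem pdo_symbolPiece_eq {d : ℕ} {m : ℝ} {a : RD d → RD d → ℂ} (D : LPData d)
    (ha : IsSymbolS11 d m a) (n j k : ℕ) (f : 𝓢(RD d, ℂ)) (x : RD d) :
    pdo (symbolPiece D a (j + 1) k) f x =
      ∫ z : RD d × ℝ, D.φ z.1 * ((1 - z.2) ^ n / n.factorial : ℝ) *
        (∫ ξ, iteratedFDeriv ℝ (n + 1) (fun x => a x ξ)
            (x + z.2 • (-((2 : ℝ) ^ (j + 1))⁻¹) • z.1) (fun _ => (-((2 : ℝ) ^ (j + 1))⁻¹) • z.1) *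
          LPhat D k ξ * 𝓕 (LPstar D k f) ξ *
          Complex.exp (2 * Real.pi * Complex.I * ((⟪x, ξ⟫ : ℝ) : ℂ)))
        ∂(volume.prod (volume.restrict (Set.Ioc 0 1))) := by
  set r : ℝ := -((2 : ℝ) ^ (j + 1))⁻¹
  set ν : Measure (RD d × ℝ) := volume.prod (volume.restrict (Set.Ioc 0 1))
  set P : RD d × ℝ → RD d → ℂ := fun z ξ =>
    iteratedFDeriv ℝ (n + 1) (fun x => a x ξ) (x + z.2 • r • z.1) fun _ => r • z.1
  set c : RD d × ℝ → ℂ := fun z => D.φ z.1 * ((1 - z.2) ^ n / n.factorial : ℝ)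
  set H : RD d → ℂ := fun ξ => LPhat D k ξ * fourierS f ξ *
    Complex.exp (2 * Real.pi * Complex.I * ((⟪x, ξ⟫ : ℝ) : ℂ))
  obtain ⟨B, hB, hPB⟩ := ha.exists_iteratedFDeriv_le (n + 1) 0
  have hP (z ξ) : ‖P z ξ‖ ≤ B * ‖r • z.1‖ ^ (n + 1) * (1 + ‖ξ‖) ^ (m + (n + 1 : ℕ)) := by
    simpa only [norm_iteratedFDeriv_zero, Nat.cast_zero, sub_zero] using
      hPB (x + z.2 • r • z.1) (r • z.1) 0 le_rfl ξ
  have hPcont : Continuous fun q : (RD d × ℝ) × RD d => P q.1 q.2 := by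
    have h1 : Continuous fun q : (RD d × ℝ) × RD d =>
        iteratedFDeriv ℝ (n + 1) (fun x => a x q.2) (x + q.1.2 • r • q.1.1) :=
      (contDiff_iteratedFDeriv_left ha.1 (n + 1)).continuous.comp
        (g := fun p : RD d × RD d => iteratedFDeriv ℝ (n + 1) (fun x => a x p.2) p.1)
        (f := fun q : (RD d × ℝ) × RD d => (x + q.1.2 • r • q.1.1, q.2)) (by fun_prop)
    exact h1.eval (by fun_prop)
  have hccont : Continuous c := by
    have := D.φ.continuous
    fun_prop
  have hHcont : Continuous H := by
    have := continuous_LPhat D k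
    have := (fourierS f).continuous
    fun_prop
  have hHsupp : HasCompactSupport H := (hasCompactSupport_LPhat D k).mul_right.mul_right
  have hc : ∀ᵐ z ∂ν, ‖c z‖ ≤ ‖D.φ z.1‖ := by
    filter_upwards [ae_norm_taylor_weight_le_one n] with z hz
    rw [norm_mul]
    exact mul_le_of_le_one_right (norm_nonneg _) hz
  have hφ : Integrable (fun z : RD d × ℝ => ‖D.φ z.1‖ * (B * ‖r • z.1‖ ^ (n + 1))) ν := by
    have h := ((D.φ.integrable_pow_mul volume (n + 1)).const_mul (B * ‖r‖ ^ (n + 1))).comp_fst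
      (volume.restrict (Set.Ioc (0 : ℝ) 1))
    refine h.congr (ae_of_all _ fun z => ?_)
    simp only [norm_smul, mul_pow]
    ring
  have hw : Integrable (fun ξ : RD d => (1 + ‖ξ‖) ^ (m + (n + 1 : ℕ)) * ‖H ξ‖) := by
    refine Continuous.integrable_of_hasCompactSupport ?_ hHsupp.norm.mul_left
    refine Continuous.mul ?_ hHcont.norm
    exact Continuous.rpow_const (by fun_prop) fun ξ => Or.inl (by positivity)
  have hint : Integrable (fun q : (RD d × ℝ) × RD d => c q.1 * (P q.1 q.2 * H q.2))
      (ν.prod volume) := by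
    refine (hφ.mul_prod hw).mono' (by fun_prop) ?_
    filter_upwards [Measure.quasiMeasurePreserving_fst.ae hc] with q hq
    rw [norm_mul (c _), norm_mul (P _ _)]
    calc _ ≤ ‖D.φ q.1.1‖ * ((B * ‖r • q.1.1‖ ^ (n + 1) * (1 + ‖q.2‖) ^ (m + (n + 1 : ℕ))) *
          ‖H q.2‖) := by
          exact mul_le_mul hq (mul_le_mul_of_nonneg_right (hP _ _) (norm_nonneg _))
            (by positivity) (by positivity)
      _ = _ := by ring
  have hintξ (ξ) : Integrable (fun z => c z * P z ξ) ν := by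
    refine (hφ.mul_const ((1 + ‖ξ‖) ^ (m + (n + 1 : ℕ)))).mono' ?_ ?_
    · exact (hccont.mul (hPcont.comp
        (by fun_prop : Continuous fun z => (z, ξ)))).aestronglyMeasurable
    filter_upwards [hc] with z hz
    rw [norm_mul, mul_assoc]
    gcongr
    exact hP _ _
  have hsymb (ξ) : ∫ y, LPkernel D (j + 1) y * a (x - y) ξ = ∫ z, c z * P z ξ ∂ν := by
    obtain ⟨A, hA⟩ := ha.norm_le ξ
    rw [integral_LPkernel_succ_mul D j (fun y => a y ξ) x,
      integral_mul_eq_integral_mul_taylor_remainder D.fourierS_eventuallyEq_zero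
        (ha.contDiff_left ξ) hA n x r, integral_prod _ (hintξ ξ)]
    congr 1 with w
    rw [intervalIntegral.integral_of_le zero_le_one, ← integral_const_mul]
    congr 1 with t
    simp only [c, P, real_smul]
    ring
  calc pdo (symbolPiece D a (j + 1) k) f x = ∫ ξ, ∫ z, c z * (P z ξ * H ξ) ∂ν := by
        unfold pdo symbolPiece
        congr 1 with ξ
        rw [hsymb]
        simp_rw [← mul_assoc (c _), integral_mul_const]
        simp only [H]
        ring
    _ = ∫ z, (∫ ξ, c z * (P z ξ * H ξ)) ∂ν := (integral_integral_swap hint).symm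
    _ = _ := by
        congr 1 with z
        rw [← integral_const_mul]
        congr 1 with ξ
        simp only [H, c, ← LPhat_mul_fourier_LPstar]
        ring

/-- Off-diagonal decay of arbitrary integer order, with the gain stated in real powers of `2`. -/
theorem exists_enorm_pdo_symbolPiece_le {d : ℕ} {m : ℝ} {a : RD d → RD d → ℂ} (D : LPData d)
    (ha : IsSymbolS11 d m a) (σ : ℝ) (n : ℕ) :
    ∃ C : ℝ≥0, ∀ (j k : ℕ) (x : RD d) (f : 𝓢(RD d, ℂ)),
      ‖pdo (symbolPiece D a (j + 1) k) f x‖ₑ ≤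
        C * ENNReal.ofReal (((2 : ℝ) ^ (j + 1))⁻¹ ^ (n + 1) * 2 ^ (k * (m + (n + 1 : ℕ)))) *
          peetre σ (2 ^ k) (LPstar D k f) x := by
  obtain ⟨l, hl⟩ := exists_nat_gt (d + σ)
  obtain ⟨C, hC⟩ := exists_enorm_multiplier_le D (m + (n + 1 : ℕ)) σ l hl
  obtain ⟨B, hB, hPB⟩ := ha.exists_iteratedFDeriv_le (n + 1) l
  set I : ℝ := ∫ w : RD d, ‖w‖ ^ (n + 1) * ‖D.φ w‖
  have hI : 0 ≤ I := integral_nonneg fun w => by positivity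
  refine ⟨C * (B * I).toNNReal, fun j k x f => ?_⟩
  set r : ℝ := -((2 : ℝ) ^ (j + 1))⁻¹
  set M : ℝ≥0∞ := peetre σ (2 ^ k) (LPstar D k f) x
  set Q : ℝ := ((2 : ℝ) ^ (j + 1))⁻¹ ^ (n + 1) * 2 ^ (k * (m + (n + 1 : ℕ)))
  have hr (w : RD d) : B * ‖r • w‖ ^ (n + 1) * 2 ^ (k * (m + (n + 1 : ℕ))) =
      B * Q * ‖w‖ ^ (n + 1) := by
    have : ‖r‖ = ((2 : ℝ) ^ (j + 1))⁻¹ := by simp [r]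
    rw [norm_smul, mul_pow, this]
    ring
  rw [pdo_symbolPiece_eq D ha n j k f x]
  refine (enorm_integral_le_lintegral_enorm _).trans ?_
  calc _ ≤ ∫⁻ z : RD d × ℝ, C * M * ENNReal.ofReal (B * Q * (‖z.1‖ ^ (n + 1) * ‖D.φ z.1‖))
          ∂(volume.prod (volume.restrict (Set.Ioc 0 1))) := by
        refine lintegral_mono_ae ?_
        filter_upwards [ae_norm_taylor_weight_le_one n] with z hz
        have hmult := hC k _ (B * ‖r • z.1‖ ^ (n + 1)) (by positivity)
          (ha.contDiff_iteratedFDeriv_apply (n + 1) (x + z.2 • r • z.1) (r • z.1))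
          (hPB (x + z.2 • r • z.1) (r • z.1)) _ (integrable_LPstar D k f) x
        rw [hr] at hmult
        rw [enorm_mul, enorm_mul]
        have hz' : ‖(((1 - z.2) ^ n / n.factorial : ℝ) : ℂ)‖ₑ ≤ 1 := by
          rw [← ofReal_norm]
          simpa using ENNReal.ofReal_le_ofReal hz
        calc _ ≤ ‖D.φ z.1‖ₑ * 1 * (C * ENNReal.ofReal (B * Q * ‖z.1‖ ^ (n + 1)) * M) := by
              gcongr
          _ = _ := by
              rw [← mul_assoc (B * Q), ENNReal.ofReal_mul (p := B * Q * _) (by positivity),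
                ofReal_norm]
              ring
    _ = C * M * ENNReal.ofReal (B * Q * I) := by
        have hφ := ((D.φ.integrable_pow_mul volume (n + 1)).const_mul (B * Q)).comp_fst
          (volume.restrict (Set.Ioc (0 : ℝ) 1))
        have := D.φ.continuous.measurable
        rw [lintegral_const_mul _ (by fun_prop), ← ofReal_integral_eq_lintegral_ofReal hφ
          (ae_of_all _ fun z => by positivity),
          integral_fun_fst (fun w : RD d => B * Q * (‖w‖ ^ (n + 1) * ‖D.φ w‖)),
          integral_const_mul]
        simp [I]
    _ = _ := by
        push_cast
        change _ = C * ENNReal.ofReal (B * I) * _ * _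
        rw [show B * Q * I = B * I * Q by ring, ENNReal.ofReal_mul (by positivity)]
        ring

theorem ofReal_dyadic_gain_le {m N : ℝ} {j k L : ℕ} (hN : N ≤ L) (hkj : k ≤ j) :
    ENNReal.ofReal (((2 : ℝ) ^ j)⁻¹ ^ L * 2 ^ (k * (m + L))) ≤
      (2 : ℝ≥0∞) ^ ((k : ℝ) * m) * (2 : ℝ≥0∞) ^ (-(((j : ℝ) - (k : ℝ)) * N)) := by
  have hkj' : (k : ℝ) ≤ j := by exact_mod_cast hkj
  have h : ((2 : ℝ) ^ j)⁻¹ ^ L = 2 ^ (-(j * L) : ℝ) := by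
    rw [inv_pow, ← pow_mul, Real.rpow_neg zero_le_two, ← Nat.cast_mul, Real.rpow_natCast]
  rw [h, ← Real.rpow_add two_pos, ← ENNReal.rpow_add _ _ two_ne_zero ENNReal.ofNat_ne_top,
    ← ENNReal.ofReal_rpow_of_pos two_pos, ENNReal.ofReal_ofNat]
  refine ENNReal.rpow_le_rpow_of_exponent_le one_le_two ?_
  nlinarith [mul_le_mul_of_nonneg_left hN (sub_nonneg.2 hkj')]

end Auxiliary

/-- the pointwise bound
`|T_{a_{j,k}} f(x)| ≲ 2^{km} 2^{-(j-k)N} 𝔐_{σ,2^k}(Π*_k f)(x)` for `j ≥ 3`, `k ≤ j-3`. -/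
theorem statement14 (d : ℕ) (hd : 1 ≤ d) (m : ℝ)
    (D : LPData d) (a : RD d → RD d → ℂ) (ha : IsSymbolS11 d m a) :
    ∀ N σ : ℝ, 0 < N → 0 < σ → ∃ C : ℝ≥0, ∀ j k : ℕ, 3 ≤ j → k + 3 ≤ j →
      ∀ (x : RD d) (f : 𝓢(RD d, ℂ)),
        (‖pdo (symbolPiece D a j k) f x‖₊ : ℝ≥0∞) ≤
          (C : ℝ≥0∞) * (2:ℝ≥0∞)^((k:ℝ)*m) * (2:ℝ≥0∞)^(-(((j:ℝ)-(k:ℝ))*N)) *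
            peetre σ ((2:ℝ)^k) (LPstar D k (⇑f)) x := by
  intro N σ _ _
  obtain ⟨n, hn⟩ := exists_nat_ge N
  obtain ⟨C, hC⟩ := exists_enorm_pdo_symbolPiece_le D ha σ n
  refine ⟨C, fun j k hj hkj x f => ?_⟩
  obtain ⟨i, rfl⟩ : ∃ i, j = i + 1 := ⟨j - 1, by omega⟩
  refine (hC i k x f).trans ?_
  rw [mul_assoc (C : ℝ≥0∞) (2 ^ _)]
  gcongr
  exact ofReal_dyadic_gain_le (hn.trans (by exact_mod_cast n.le_succ)) (by omega)

end
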